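/- Consider a finite discounted MDP with state set S, action set A, transition probabilities P, reward function R taking values in [0,1], and discount factor γ ∈ (0,1), with Bellman optimality operator H, and set r = 1/(1−γ). Let W be any linear subspace of ℝ^{S×A}, let D be a diagonal matrix on ℝ^{S×A} with strictly positive diagonal entries, let Proj_W denote orthogonal projection onto W with respect to the inner product ⟨x,y⟩_D = xᵀDy, and let ⌈·⌉ denote componentwise truncation at level r. Then the truncated projected Bellman operator T(Q) = ⌈Proj_W(H(Q))⌉ is a continuous map from the ℓ∞-ball B_r = {Q : ‖Q‖∞ ≤ r} into itself, and there exists Q̄ ∈ B_r with Q̄ = ⌈Proj_W(H(Q̄))⌉; i.e., the truncated projected Bellman equation has at least one solution. -/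

import Mathlib

/-- Componentwise truncation at level `r`. -/
noncomputable def trunc {ι : Type*} (r : ℝ) (x : ι → ℝ) : ι → ℝ :=
  fun i => max (-r) (min r (x i))

/-- A finite set `R` is dominant for the family of utilities `u` if no point is strictly better
than the `u i`-worst point of `R` for every index `i` simultaneously. -/
def IsDominant {V I : Type*} (u : I → V → ℕ) (R : Finset V) : Prop :=
  ∀ y, ∃ i, ∀ x ∈ R, u i y ≤ u i x

lemma IsDominant.mono {V I : Type*} {u : I → V → ℕ} {R R' : Finset V}
    (h : IsDominant u R) (hR : R' ⊆ R) : IsDominant u R' := fun y =>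
  (h y).imp fun _ hi x hx => hi x (hR hx)

section Scarf

open Finset
open scoped Classical

variable {V I : Type*} [Fintype I]

/-- If a set with as many elements as there are colours misses a colour, then the number of its
facets carrying exactly the colours other than `i₀` is even. -/
lemma even_card_facets (c : V → I) (i₀ : I) (R : Finset V) (hR : #R = Fintype.card I)
    (hc : R.image c ≠ univ) :
    Even #{x ∈ R | (R.erase x).image c = univ.erase i₀} := by
  rcases Finset.eq_empty_or_nonempty {x ∈ R | (R.erase x).image c = univ.erase i₀} with h | ⟨x, hx⟩
  · rw [h]; simp
  have key : ∀ z ∈ R, (R.erase z).image c = univ.erase i₀ → ∃ w ∈ R, w ≠ z ∧ c w = c z := by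
    intro z hz h
    have hzi : c z ≠ i₀ := by
      intro hzi
      apply hc
      rw [← insert_erase hz, image_insert, h, hzi, insert_erase (mem_univ _)]
    have : c z ∈ (R.erase z).image c := by rw [h]; simp [hzi]
    obtain ⟨w, hw, hwz⟩ := mem_image.1 this
    exact ⟨w, mem_of_mem_erase hw, ne_of_mem_erase hw, hwz⟩
  obtain ⟨hxR, hxc⟩ := mem_filter.1 hx
  obtain ⟨x', hx'R, hne, hcx⟩ := key x hxR hxc
  have hinj : Set.InjOn c (R.erase x) := by
    apply injOn_of_card_image_eq
    rw [hxc, card_erase_of_mem (mem_univ _), card_erase_of_mem hxR, hR, card_univ]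
  have hset : {z ∈ R | (R.erase z).image c = univ.erase i₀} = {x, x'} := by
    ext z
    simp only [mem_filter, mem_insert, mem_singleton]
    constructor
    · rintro ⟨hz, hzc⟩
      by_contra! hzx
      obtain ⟨w, hw, hwz, hcw⟩ := key z hz hzc
      by_cases hwx : w = x
      · subst hwx
        exact hzx.2 (hinj (by simp [hz, hzx.1]) (by simp [hx'R, hne]) (by rw [hcx, hcw]))
      · exact hwz (hinj (by simp [hw, hwx]) (by simp [hz, hzx.1]) hcw)
    · rintro (rfl | rfl)
      · exact ⟨hxR, hxc⟩
      · refine ⟨hx'R, ?_⟩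
        rw [← hxc]
        ext j
        simp only [mem_image, mem_erase]
        constructor
        · rintro ⟨w, ⟨hw, hwR⟩, rfl⟩
          by_cases hwx : w = x
          · exact ⟨z, ⟨hne, hx'R⟩, by rw [hcx, hwx]⟩
          · exact ⟨w, ⟨hwx, hwR⟩, rfl⟩
        · rintro ⟨w, ⟨hw, hwR⟩, rfl⟩
          by_cases hwx : w = z
          · exact ⟨x, ⟨hne.symm, hxR⟩, by rw [← hcx, hwx]⟩
          · exact ⟨w, ⟨hwx, hwR⟩, rfl⟩
  rw [hset, card_pair hne.symm]
  exact even_two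

variable [Fintype V]

/-- The `f`-maximal elements of a nonempty finite set form a singleton when `f` is injective. -/
lemma card_filter_isMax_eq_one {f : V → ℕ} (hf : Function.Injective f) {s : Finset V}
    (hs : s.Nonempty) : #{y ∈ s | ∀ z ∈ s, f z ≤ f y} = 1 := by
  obtain ⟨y, hy, hmax⟩ := s.exists_max_image f hs
  rw [card_eq_one]
  refine ⟨y, ?_⟩
  ext z
  simp only [mem_filter, mem_singleton]
  constructor
  · rintro ⟨hz, h⟩
    exact hf (le_antisymm (hmax z hz) (h y hy))
  · rintro rfl
    exact ⟨hy, hmax⟩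

/-- A set with one element fewer than there are indices, which can be strictly improved in all
indices but any given one, has an even number of dominant one-point extensions. -/
lemma even_card_dominant_extensions {u : I → V → ℕ} (hu : ∀ i, Function.Injective (u i))
    (τ : Finset V) (hτ : #τ + 1 = Fintype.card I) (hne : τ.Nonempty)
    (hext : ∀ k, ∃ y, ∀ i, i ≠ k → ∃ x ∈ τ, u i x < u i y) :
    Even #{y | y ∉ τ ∧ IsDominant u (insert y τ)} := by
  by_cases hdom : IsDominant u τ
  swap
  · have : ({y | y ∉ τ ∧ IsDominant u (insert y τ)} : Finset V) = ∅ := by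
      apply filter_eq_empty_iff.2
      rintro y - ⟨-, h⟩
      exact hdom (h.mono (subset_insert _ _))
    rw [this]; simp
  choose m hmτ hm using fun i => τ.exists_min_image (u i) hne
  have hsurj : ∀ x ∈ τ, ∃ i, m i = x := by
    intro x hx
    obtain ⟨i, hi⟩ := hdom x
    exact ⟨i, hu i (le_antisymm (hm i x hx) (hi _ (hmτ i)))⟩
  have hinj : ∀ k, (∀ x ∈ τ, ∃ i, i ≠ k ∧ m i = x) → Set.InjOn m (univ.erase k : Finset I) := by
    intro k hk
    apply injOn_of_card_image_eq
    have : (univ.erase k).image m = τ := by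
      ext x
      simp only [mem_image, mem_erase, mem_univ, and_true]
      constructor
      · rintro ⟨i, -, rfl⟩; exact hmτ i
      · intro hx
        exact hk x hx
    rw [this, card_erase_of_mem (mem_univ _), card_univ]
    omega
  obtain ⟨a, -, b, -, hab, hmab⟩ := exists_ne_map_eq_of_card_lt_of_maps_to
    (s := (univ : Finset I)) (t := τ) (f := m) (by rw [card_univ]; omega) (fun i _ => hmτ i)
  have hsurj' : ∀ k, k = a ∨ k = b → ∀ x ∈ τ, ∃ i, i ≠ k ∧ m i = x := by
    intro k hk x hx
    obtain ⟨i, rfl⟩ := hsurj x hx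
    by_cases hik : i = k
    · subst hik
      rcases hk with rfl | rfl
      · exact ⟨b, hab.symm, hmab.symm⟩
      · exact ⟨a, hab, hmab⟩
    · exact ⟨i, hik, rfl⟩
  let Cand : I → Finset V := fun k => {y | ∀ i, i ≠ k → u i (m i) < u i y}
  have hCand : ∀ k y, y ∈ Cand k ↔ ∀ i, i ≠ k → u i (m i) < u i y := by
    intro k y; simp [Cand]
  have hCandne : ∀ k, (Cand k).Nonempty := by
    intro k
    obtain ⟨y, hy⟩ := hext k
    refine ⟨y, (hCand k y).2 fun i hi => ?_⟩
    obtain ⟨x, hx, hxy⟩ := hy i hi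
    exact (hm i x hx).trans_lt hxy
  have hCandle : ∀ k, ∀ y ∈ Cand k, ∀ x ∈ τ, u k y ≤ u k x := by
    intro k y hy x hx
    obtain ⟨i, hi⟩ := hdom y
    by_cases hik : i = k
    · subst hik; exact hi x hx
    · exact absurd (hi _ (hmτ i)) (not_le.2 ((hCand k y).1 hy i hik))
  have hset : ({y | y ∉ τ ∧ IsDominant u (insert y τ)} : Finset V) =
      {y ∈ Cand a | ∀ z ∈ Cand a, u a z ≤ u a y} ∪
      {y ∈ Cand b | ∀ z ∈ Cand b, u b z ≤ u b y} := by
    have hback : ∀ k, k = a ∨ k = b → ∀ y ∈ Cand k, (∀ z ∈ Cand k, u k z ≤ u k y) →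
        y ∉ τ ∧ IsDominant u (insert y τ) := by
      intro k hk y hy hmax
      constructor
      · intro hyτ
        obtain ⟨i, hik, hi⟩ := hsurj' k hk y hyτ
        have := (hCand k y).1 hy i hik
        rw [hi] at this
        exact lt_irrefl _ this
      · intro z
        by_cases hz : z ∈ Cand k
        · refine ⟨k, ?_⟩
          simp only [mem_insert, forall_eq_or_imp]
          exact ⟨hmax z hz, hCandle k z hz⟩
        · rw [hCand] at hz
          push Not at hz
          obtain ⟨i, hik, hi⟩ := hz
          refine ⟨i, ?_⟩
          simp only [mem_insert, forall_eq_or_imp]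
          exact ⟨hi.trans ((hCand k y).1 hy i hik).le, fun x hx => hi.trans (hm i x hx)⟩
    have hforw : ∀ y, y ∉ τ → IsDominant u (insert y τ) →
        ∃ k, (k = a ∨ k = b) ∧ y ∈ Cand k ∧ ∀ z ∈ Cand k, u k z ≤ u k y := by
      intro y hy hd
      obtain ⟨k, hk⟩ := hd y
      have hother : ∀ x ∈ τ, ∃ i, i ≠ k ∧ m i = x ∧ u i x < u i y := by
        intro x hx
        obtain ⟨i, hi⟩ := hd x
        have hxy : x ≠ y := fun h => hy (h ▸ hx)
        have hlt : u i x < u i y :=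
          lt_of_le_of_ne (hi y (mem_insert_self _ _)) fun h => hxy (hu i h)
        refine ⟨i, ?_, hu i (le_antisymm (hm i x hx) (hi _ (mem_insert_of_mem (hmτ i)))), hlt⟩
        rintro rfl
        exact absurd (hk x (mem_insert_of_mem hx)) (not_le.2 hlt)
      have hi := hinj k fun x hx => (hother x hx).imp fun i h => ⟨h.1, h.2.1⟩
      refine ⟨k, ?_, ?_, ?_⟩
      · by_contra! hkab
        exact hab (hi (by simp [hkab.1.symm]) (by simp [hkab.2.symm]) hmab)
      · rw [hCand]
        intro i hik
        obtain ⟨j, hjk, hj, hlt⟩ := hother (m i) (hmτ i)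
        have : j = i := hi (by simp [hjk]) (by simp [hik]) hj
        rwa [this] at hlt
      · intro z hz
        obtain ⟨i, hle⟩ := hd z
        by_cases hik : i = k
        · subst hik; exact hle y (mem_insert_self _ _)
        · exact absurd (hle _ (mem_insert_of_mem (hmτ i))) (not_le.2 ((hCand k z).1 hz i hik))
    ext y
    simp only [mem_filter, mem_univ, true_and, mem_union]
    constructor
    · rintro ⟨hy, hd⟩
      obtain ⟨k, rfl | rfl, h⟩ := hforw y hy hd
      · exact Or.inl h
      · exact Or.inr h
    · rintro (h | h)
      · exact hback a (Or.inl rfl) y h.1 h.2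
      · exact hback b (Or.inr rfl) y h.1 h.2
  have hdisj : Disjoint {y ∈ Cand a | ∀ z ∈ Cand a, u a z ≤ u a y}
      {y ∈ Cand b | ∀ z ∈ Cand b, u b z ≤ u b y} := by
    rw [Finset.disjoint_left]
    intro y hya hyb
    have hya := (mem_filter.1 hya).1
    have hyb := (mem_filter.1 hyb).1
    have h1 := hCandle b y hyb (m b) (hmτ b)
    exact absurd ((hCand a y).1 hya b hab.symm) (not_lt.2 h1)
  rw [hset, card_union_of_disjoint hdisj, card_filter_isMax_eq_one (hu a) (hCandne a),
    card_filter_isMax_eq_one (hu b) (hCandne b)]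
  exact even_two

/-- The set of all slack points except `s i₀` has exactly one dominant one-point extension. -/
lemma card_dominant_extensions_slack {u : I → V → ℕ} (hu : ∀ i, Function.Injective (u i))
    {s : I → V} (hmin : ∀ i v, u i (s i) ≤ u i v)
    (hmax : ∀ i j, j ≠ i → ∀ v, v ∉ Set.range s → u j v < u j (s i))
    (hT : ∃ t, t ∉ Set.range s) (i₀ : I) :
    #{y | y ∉ (univ.erase i₀).image s ∧ IsDominant u (insert y ((univ.erase i₀).image s))} = 1 := by
  have hmin' : ∀ i v, v ∉ Set.range s → u i (s i) < u i v := fun i v hv =>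
    lt_of_le_of_ne (hmin i v) fun h => hv ⟨i, hu i h⟩
  have hTne : ({t | t ∉ Set.range s} : Finset V).Nonempty := by
    obtain ⟨t, ht⟩ := hT
    exact ⟨t, by simpa using ht⟩
  rw [← card_filter_isMax_eq_one (hu i₀) hTne]
  congr 1
  ext y
  simp only [mem_filter, mem_univ, true_and]
  have hsub : ∀ t, t ∉ Set.range s → IsDominant u (insert y ((univ.erase i₀).image s)) →
      u i₀ t ≤ u i₀ y := by
    intro t ht hd
    obtain ⟨i, hi⟩ := hd t
    by_cases hii : i = i₀
    · subst hii; exact hi y (mem_insert_self _ _)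
    · exact absurd (hi (s i) (mem_insert_of_mem (mem_image_of_mem s (by simp [hii]))))
        (not_le.2 (hmin' i t ht))
  constructor
  · rintro ⟨hy, hd⟩
    refine ⟨?_, fun t ht => hsub t ht hd⟩
    rintro ⟨i, rfl⟩
    obtain ⟨t, ht⟩ := hT
    by_cases hii : i = i₀
    · subst hii
      exact absurd (hsub t ht hd) (not_le.2 (hmin' i t ht))
    · exact hy (mem_image_of_mem s (by simp [hii]))
  · rintro ⟨hy, hmx⟩
    refine ⟨fun h => ?_, fun z => ?_⟩
    · obtain ⟨i, -, hi⟩ := mem_image.1 h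
      exact hy ⟨i, hi⟩
    · by_cases hz : z ∈ Set.range s
      · obtain ⟨i, rfl⟩ := hz
        exact ⟨i, fun x _ => hmin i x⟩
      · refine ⟨i₀, fun x hx => ?_⟩
        rcases mem_insert.1 hx with rfl | hx
        · exact hmx z hz
        · obtain ⟨i, hi, rfl⟩ := mem_image.1 hx
          exact (hmax i i₀ (ne_of_mem_erase hi).symm z hz).le

/-- A finite set of pairs is counted by summing the sizes of its fibres over the first factor. -/
lemma card_filter_prod_eq_sum {α β : Type*} [Fintype α] [Fintype β] (S : Finset (α × β))
    (p : α → Prop) (q : α → β → Prop) [DecidablePred p] [∀ a, DecidablePred (q a)]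
    (hS : ∀ x, x ∈ S ↔ p x.1 ∧ q x.1 x.2) :
    #S = ∑ a with p a, #{b | q a b} := by
  rw [card_eq_sum_card_fiberwise (f := Prod.fst) (t := ({a | p a} : Finset α))]
  · refine sum_congr rfl fun a ha => ?_
    refine card_nbij' Prod.snd (fun b => (a, b)) ?_ ?_ ?_ ?_
    · rintro ⟨a', b⟩ h
      simp only [coe_filter, hS, mem_univ, true_and, Set.mem_ofPred_eq] at h ⊢
      obtain ⟨⟨-, h⟩, rfl⟩ := h
      exact h
    · intro b h
      simp only [coe_filter, hS, mem_univ, true_and, Set.mem_ofPred_eq, and_true] at h ⊢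
      exact ⟨(mem_filter.1 ha).2, h⟩
    · rintro ⟨a', b⟩ h
      simp only [coe_filter, Set.mem_ofPred_eq] at h
      exact Prod.ext h.2.symm rfl
    · intro b _
      rfl
  · intro x h
    simpa using ((hS x).1 h).1

/-- Scarf's lemma: given slack points `s i` that are `u i`-minimal and `u j`-above every ordinary
point for `j ≠ i`, every colouring giving `s i` the colour `i` has a dominant set in which
every colour occurs. -/
theorem exists_dominant_image_eq_univ [Nonempty I] {u : I → V → ℕ}
    (hu : ∀ i, Function.Injective (u i))
    {s : I → V} (hmin : ∀ i v, u i (s i) ≤ u i v)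
    (hmax : ∀ i j, j ≠ i → ∀ v, v ∉ Set.range s → u j v < u j (s i))
    (hT : ∃ t, t ∉ Set.range s) (c : V → I) (hc : ∀ i, c (s i) = i) :
    ∃ R : Finset V, IsDominant u R ∧ R.image c = univ := by
  by_contra! hno
  obtain ⟨i₀⟩ := ‹Nonempty I›
  let roomFlags : Finset (Finset V × V) :=
    {p | (IsDominant u p.1 ∧ #p.1 = Fintype.card I) ∧
      p.2 ∈ p.1 ∧ (p.1.erase p.2).image c = univ.erase i₀}
  let doorFlags : Finset (Finset V × V) :=
    {p | (#p.1 + 1 = Fintype.card I ∧ p.1.image c = univ.erase i₀) ∧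
      p.2 ∉ p.1 ∧ IsDominant u (insert p.2 p.1)}
  have hflags : #roomFlags = #doorFlags := by
    refine card_nbij' (fun p => (p.1.erase p.2, p.2)) (fun p => (insert p.2 p.1, p.2)) ?_ ?_ ?_ ?_
    · rintro ⟨R, x⟩ h
      simp only [roomFlags, doorFlags, coe_filter, mem_univ, true_and, Set.mem_ofPred_eq] at h ⊢
      obtain ⟨⟨hd, hR⟩, hx, hi⟩ := h
      refine ⟨⟨?_, hi⟩, notMem_erase _ _, by rwa [insert_erase hx]⟩
      rw [card_erase_add_one hx, hR]
    · rintro ⟨τ, y⟩ h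
      simp only [roomFlags, doorFlags, coe_filter, mem_univ, true_and, Set.mem_ofPred_eq] at h ⊢
      obtain ⟨⟨hτ, hi⟩, hy, hd⟩ := h
      refine ⟨⟨hd, ?_⟩, mem_insert_self _ _, by rwa [erase_insert hy]⟩
      rw [card_insert_of_notMem hy, hτ]
    · rintro ⟨R, x⟩ h
      simp only [roomFlags, coe_filter, mem_univ, true_and, Set.mem_ofPred_eq] at h
      simp [insert_erase h.2.1]
    · rintro ⟨τ, y⟩ h
      simp only [doorFlags, coe_filter, mem_univ, true_and, Set.mem_ofPred_eq] at h
      simp [erase_insert h.2.1]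
  have hrooms : Even #roomFlags := by
    rw [card_filter_prod_eq_sum roomFlags (fun R => IsDominant u R ∧ #R = Fintype.card I)
      (fun R x => x ∈ R ∧ (R.erase x).image c = univ.erase i₀)
      (fun x => by simp [roomFlags])]
    refine even_sum _ fun R hR => ?_
    obtain ⟨hd, hR⟩ := (mem_filter.1 hR).2
    have hset : ({x | x ∈ R ∧ (R.erase x).image c = univ.erase i₀} : Finset V) =
        {x ∈ R | (R.erase x).image c = univ.erase i₀} := by
      ext x
      simp
    rw [hset]
    exact even_card_facets c i₀ R hR (hno R hd)
  have himage : ((univ.erase i₀).image s).image c = univ.erase i₀ := by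
    rw [image_image, show c ∘ s = id from funext hc, image_id]
  have hslack : (univ.erase i₀).image s ∈
      ({τ | #τ + 1 = Fintype.card I ∧ τ.image c = univ.erase i₀} : Finset (Finset V)) := by
    rw [mem_filter]
    refine ⟨mem_univ _, ?_, himage⟩
    rw [card_image_of_injective _ (Function.LeftInverse.injective hc),
      card_erase_add_one (mem_univ _), card_univ]
  have hdoors : Odd #doorFlags := by
    rw [card_filter_prod_eq_sum doorFlags (fun τ => #τ + 1 = Fintype.card I ∧ τ.image c = univ.erase i₀)
      (fun τ y => y ∉ τ ∧ IsDominant u (insert y τ))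
      (fun x => by simp [doorFlags]), ← add_sum_erase _ _ hslack,
      card_dominant_extensions_slack hu hmin hmax hT i₀]
    refine odd_one.add_even (even_sum _ fun τ hτ => ?_)
    obtain ⟨hne, hτ⟩ := mem_erase.1 hτ
    obtain ⟨-, hτcard, hτc⟩ := mem_filter.1 hτ
    have hordinary : ∃ t ∈ τ, t ∉ Set.range s := by
      by_contra! hsub
      apply hne
      have hsc : ∀ x ∈ τ, s (c x) = x := by
        intro x hx
        obtain ⟨i, rfl⟩ := hsub x hx
        rw [hc]
      rw [← hτc, image_image]
      ext x
      simp only [mem_image, Function.comp_apply]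
      constructor
      · intro hx
        exact ⟨x, hx, hsc x hx⟩
      · rintro ⟨y, hy, rfl⟩
        rwa [hsc y hy]
    obtain ⟨t, ht, hts⟩ := hordinary
    exact even_card_dominant_extensions hu τ hτcard ⟨t, ht⟩
      fun k => ⟨s k, fun i hi => ⟨t, ht, hmax k i hi t hts⟩⟩
  rw [hflags] at hrooms
  exact Nat.not_even_iff_odd.2 hdoors hrooms

end Scarf

section Brouwer

open Finset Filter Topology
open scoped Classical

/-- For any colouring of the grid points of the simplex of size `m`, some grid point `p` is close
to a grid point of each colour `i` for which `p i` is not small. -/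
lemma exists_grid_point_near_all_colours {I : Type*} [Fintype I] [Nonempty I] (m : ℕ)
    (c : (I → ℕ) → I) :
    ∃ p : I → ℕ, ∑ i, p i = m ∧ ∀ i, p i ≤ Fintype.card I ∨
      ∃ q : I → ℕ, ∑ j, q j = m ∧ c q = i ∧
        ∀ j, p j ≤ q j + Fintype.card I ∧ q j ≤ p j + Fintype.card I := by
  let T := {x : I → ℕ // x ∈ piAntidiag univ m}
  have hTsum : ∀ x : T, ∑ i, x.1 i = m := fun x => (mem_piAntidiag.1 x.2).1
  have hTmk : ∀ x : I → ℕ, ∑ i, x i = m → x ∈ piAntidiag univ m := fun x hx =>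
    mem_piAntidiag.2 ⟨hx, fun _ _ => mem_univ _⟩
  have hTle : ∀ (x : T) i, x.1 i ≤ m := fun x i =>
    (single_le_sum (f := x.1) (fun _ _ => Nat.zero_le _) (mem_univ i)).trans_eq (hTsum x)
  let _ : Fintype T := inferInstanceAs (Fintype (piAntidiag (univ : Finset I) m))
  let e := Fintype.equivFin (T ⊕ I)
  let N := Fintype.card (T ⊕ I)
  let w : I → T ⊕ I → ℕ := fun i => Sum.elim (fun x => x.1 i + 1) fun j => if j = i then 0 else m + 2
  let u : I → T ⊕ I → ℕ := fun i v => w i v * N + (e v : ℕ)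
  have hdiv : ∀ i v, u i v / N = w i v := by
    intro i v
    have hN : 0 < N := (Nat.zero_le _).trans_lt (e v).2
    simp only [u]
    rw [Nat.add_comm, Nat.add_mul_div_right _ _ hN, Nat.div_eq_of_lt (e v).2, zero_add]
  have hmod : ∀ i v, u i v % N = e v := by
    intro i v
    simp only [u]
    rw [Nat.add_comm, Nat.add_mul_mod_self_right, Nat.mod_eq_of_lt (e v).2]
  have hu : ∀ i, Function.Injective (u i) := by
    intro i v v' h
    apply e.injective
    apply Fin.ext
    rw [← hmod i v, ← hmod i v', h]
  have hle : ∀ i v v', u i v ≤ u i v' → w i v ≤ w i v' := by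
    intro i v v' h
    rw [← hdiv, ← hdiv]
    exact Nat.div_le_div_right h
  have hlt : ∀ i v v', w i v < w i v' → u i v < u i v' := fun i v v' h =>
    lt_of_not_ge fun h' => absurd (hle i _ _ h') (not_le.2 h)
  let i₁ : I := Classical.arbitrary I
  let t₁ : T := ⟨Pi.single i₁ m, hTmk _ (by simp)⟩
  obtain ⟨R, hdom, hR⟩ := exists_dominant_image_eq_univ (u := u) hu (s := Sum.inr)
    (by
      rintro i v
      by_cases hv : v = Sum.inr i
      · rw [hv]
      · refine (hlt i _ _ ?_).le
        rcases v with x | j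
        · simp [w]
        · have : j ≠ i := fun h => hv (h ▸ rfl)
          simp [w, this])
    (by
      rintro i j hji (x | k) hv
      · apply hlt
        have := hTle x j
        simp only [w, Sum.elim_inl, Sum.elim_inr, if_neg hji.symm]
        omega
      · exact absurd ⟨k, rfl⟩ hv)
    ⟨Sum.inl t₁, by simp⟩ (Sum.elim (fun x => c x.1) id) (fun i => rfl)
  let C : Finset I := {i | Sum.inr i ∉ R}
  let σ : Finset T := {x | Sum.inl x ∈ R}
  have hC : ∀ i, i ∈ C ↔ Sum.inr i ∉ R := fun i => by simp [C]
  have hσ : ∀ x, x ∈ σ ↔ Sum.inl x ∈ R := fun x => by simp [σ]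
  have hdomσ : ∀ y : T, ∃ i ∈ C, ∀ x ∈ σ, y.1 i ≤ x.1 i := by
    intro y
    obtain ⟨i, hi⟩ := hdom (Sum.inl y)
    refine ⟨i, (hC i).2 fun h => ?_, fun x hx => ?_⟩
    · have := hle i _ _ (hi _ h)
      simp [w] at this
    · have := hle i _ _ (hi _ ((hσ x).1 hx))
      simpa [w] using this
  have hcol : ∀ i ∈ C, ∃ x ∈ σ, c x.1 = i := by
    intro i hi
    have : i ∈ R.image (Sum.elim (fun x : T => c x.1) id) := by rw [hR]; exact mem_univ _
    obtain ⟨v, hv, hvi⟩ := mem_image.1 this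
    rcases v with x | j
    · exact ⟨x, (hσ x).2 hv, hvi⟩
    · have hji : j = i := hvi
      exact absurd (hji ▸ hv) ((hC i).1 hi)
  obtain ⟨k, hk, -⟩ := hdomσ t₁
  obtain ⟨p, hp, -⟩ := hcol k hk
  choose μ hμσ hμ using fun i => σ.exists_min_image (fun x => x.1 i) ⟨p, hp⟩
  have hsum : m < ∑ i ∈ C, ((μ i).1 i + 1) := by
    by_contra! hcon
    let y : I → ℕ := fun i => (if i ∈ C then (μ i).1 i + 1 else 0) +
      Pi.single (M := fun _ => ℕ) k (m - ∑ i ∈ C, ((μ i).1 i + 1)) i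
    have hy : ∑ i, y i = m := by
      simp only [y]
      rw [sum_add_distrib, sum_ite_mem, univ_inter, sum_pi_single']
      simp only [mem_univ, if_true]
      omega
    obtain ⟨i, hi, hxi⟩ := hdomσ ⟨y, hTmk y hy⟩
    have := hxi (μ i) (hμσ i)
    simp only [y, if_pos hi] at this
    omega
  have hbound : ∀ x ∈ σ, (∀ i ∈ C, x.1 i ≤ (μ i).1 i + Fintype.card I) ∧
      ∀ i ∉ C, x.1 i ≤ Fintype.card I := by
    intro x hx
    have hCcard : #C ≤ Fintype.card I := card_le_univ C
    rw [sum_add_distrib, sum_const, smul_eq_mul, mul_one] at hsum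
    have hsplit := sum_add_sum_compl C x.1
    rw [hTsum x] at hsplit
    constructor
    · intro i hi
      have h1 := add_sum_erase C x.1 hi
      have h2 := add_sum_erase C (fun i => (μ i).1 i) hi
      have h3 : ∑ j ∈ C.erase i, (μ j).1 j ≤ ∑ j ∈ C.erase i, x.1 j :=
        sum_le_sum fun j _ => hμ j x hx
      omega
    · intro i hi
      have h1 : x.1 i ≤ ∑ j ∈ Cᶜ, x.1 j :=
        single_le_sum (f := x.1) (fun _ _ => Nat.zero_le _) (mem_compl.2 hi)
      have h3 : ∑ j ∈ C, (μ j).1 j ≤ ∑ j ∈ C, x.1 j := sum_le_sum fun j _ => hμ j x hx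
      omega
  have hclose : ∀ x ∈ σ, ∀ y ∈ σ, ∀ j, x.1 j ≤ y.1 j + Fintype.card I := by
    intro x hx y hy j
    by_cases hj : j ∈ C
    · have := (hbound x hx).1 j hj
      have := hμ j y hy
      omega
    · have := (hbound x hx).2 j hj
      omega
  refine ⟨p.1, hTsum p, fun i => ?_⟩
  by_cases hi : i ∈ C
  · obtain ⟨q, hq, hqi⟩ := hcol i hi
    exact Or.inr ⟨q.1, hTsum q, hqi, fun j => ⟨hclose p hp q hq j, hclose q hq p hp j⟩⟩
  · exact Or.inl ((hbound p hp).2 i hi)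

/-- Two points of the standard simplex, one of which is coordinatewise at most the other, agree. -/
lemma eq_of_mem_stdSimplex_of_le {I : Type*} [Fintype I] {x y : I → ℝ} (hx : x ∈ stdSimplex ℝ I)
    (hy : y ∈ stdSimplex ℝ I) (h : ∀ i, x i ≤ y i) : x = y := by
  funext i
  exact (sum_eq_sum_iff_of_le fun i _ => h i).1 (hx.2.trans hy.2.symm) i (mem_univ i)

/-- **Brouwer's fixed point theorem** for the standard simplex. -/
theorem exists_fixedPoint_stdSimplex {I : Type*} [Fintype I] [Nonempty I]
    {f : (I → ℝ) → I → ℝ} (hf : ContinuousOn f (stdSimplex ℝ I))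
    (hmaps : Set.MapsTo f (stdSimplex ℝ I) (stdSimplex ℝ I)) :
    ∃ x ∈ stdSimplex ℝ I, f x = x := by
  have hcol : ∀ x ∈ stdSimplex ℝ I, ∃ i, x i ≤ f x i := by
    intro x hx
    by_contra! h
    have := eq_of_mem_stdSimplex_of_le (hmaps hx) hx fun i => (h i).le
    obtain ⟨i⟩ := ‹Nonempty I›
    exact absurd (congrFun this i) (h i).ne
  let g : ℕ → (I → ℕ) → I → ℝ := fun n x i => (x i : ℝ) / ((n : ℝ) + 1)
  have hg : ∀ n x, ∑ i, x i = n + 1 → g n x ∈ stdSimplex ℝ I := by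
    intro n x hx
    refine ⟨fun i => by positivity, ?_⟩
    simp only [g]
    rw [← sum_div, ← Nat.cast_sum, hx]
    push_cast
    exact div_self (by positivity)
  have hcol' : ∀ n, ∃ c : (I → ℕ) → I, ∀ x, ∑ i, x i = n + 1 →
      g n x (c x) ≤ f (g n x) (c x) := by
    intro n
    have : ∀ x : I → ℕ, ∃ i, ∑ i, x i = n + 1 → g n x i ≤ f (g n x) i := by
      intro x
      by_cases hx : ∑ i, x i = n + 1
      · obtain ⟨i, hi⟩ := hcol _ (hg n x hx)
        exact ⟨i, fun _ => hi⟩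
      · exact ⟨Classical.arbitrary I, fun h => absurd h hx⟩
    choose c hc using this
    exact ⟨c, hc⟩
  let δ : ℕ → ℝ := fun n => (Fintype.card I : ℝ) / ((n : ℝ) + 1)
  have hδ : Tendsto δ atTop (𝓝 0) := by
    simpa [δ, div_eq_mul_one_div (Fintype.card I : ℝ)] using
      (tendsto_one_div_add_atTop_nhds_zero_nat (𝕜 := ℝ)).const_mul (Fintype.card I : ℝ)
  have happrox : ∀ n, ∃ p ∈ stdSimplex ℝ I, ∀ i, ∃ q ∈ stdSimplex ℝ I,
      (∀ j, |q j - p j| ≤ δ n) ∧ min (p i - δ n) (q i - f q i) ≤ 0 := by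
    intro n
    obtain ⟨c, hc⟩ := hcol' n
    obtain ⟨p, hp, hpq⟩ := exists_grid_point_near_all_colours (n + 1) c
    have hn : (0 : ℝ) < (n : ℝ) + 1 := by positivity
    refine ⟨g n p, hg n p hp, fun i => ?_⟩
    rcases hpq i with h | ⟨q, hq, rfl, hclose⟩
    · refine ⟨g n p, hg n p hp, fun j => ?_, min_le_of_left_le ?_⟩
      · simp only [sub_self, abs_zero, δ]
        positivity
      · rw [sub_nonpos]
        exact div_le_div_of_nonneg_right (Nat.cast_le.2 h) hn.le
    · refine ⟨g n q, hg n q hq, fun j => ?_, min_le_of_right_le (sub_nonpos.2 (hc q hq))⟩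
      simp only [g, δ]
      rw [← sub_div, abs_div, abs_of_pos hn]
      refine div_le_div_of_nonneg_right ?_ hn.le
      have h1 : (p j : ℝ) ≤ q j + Fintype.card I := mod_cast (hclose j).1
      have h2 : (q j : ℝ) ≤ p j + Fintype.card I := mod_cast (hclose j).2
      rw [abs_le]
      constructor <;> linarith
  choose p hp q hq hpq hmin using happrox
  obtain ⟨x, hx, φ, hφ, hlim⟩ := (isCompact_stdSimplex ℝ I).tendsto_subseq hp
  have hδφ : Tendsto (fun n => δ (φ n)) atTop (𝓝 0) := hδ.comp hφ.tendsto_atTop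
  have hpj : ∀ j, Tendsto (fun n => p (φ n) j) atTop (𝓝 (x j)) := fun j =>
    (tendsto_pi_nhds.1 hlim) j
  have hqlim : ∀ i, Tendsto (fun n => q (φ n) i) atTop (𝓝 x) := by
    intro i
    rw [tendsto_pi_nhds]
    intro j
    have hd : Tendsto (fun n => q (φ n) i j - p (φ n) j) atTop (𝓝 0) :=
      squeeze_zero_norm (fun n => hpq (φ n) i j) hδφ
    simpa using hd.add (hpj j)
  have hfq : ∀ i, Tendsto (fun n => f (q (φ n) i)) atTop (𝓝 (f x)) := fun i =>
    (hf x hx).tendsto.comp (tendsto_nhdsWithin_iff.2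
      ⟨hqlim i, Eventually.of_forall fun n => hq (φ n) i⟩)
  refine ⟨x, hx, (eq_of_mem_stdSimplex_of_le hx (hmaps hx) fun i => ?_).symm⟩
  have hmlim := ((hpj i).sub hδφ).min
    (((tendsto_pi_nhds.1 (hqlim i)) i).sub ((tendsto_pi_nhds.1 (hfq i)) i))
  have hle := le_of_tendsto' hmlim fun n => hmin (φ n) i
  rw [sub_zero, min_le_iff] at hle
  have hnonneg := (hmaps hx).1 i
  rcases hle with h | h <;> linarith

/-- A continuous self-map of a finite-dimensional coordinate space with values in a cube has a
fixed point. -/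
theorem exists_fixedPoint_of_abs_le {ι : Type*} [Fintype ι] [Nonempty ι] {r : ℝ} (hr : 0 < r)
    {G : (ι → ℝ) → ι → ℝ} (hG : Continuous G) (hGr : ∀ x i, |G x i| ≤ r) :
    ∃ x, G x = x := by
  let L : ℝ := Fintype.card ι * (2 * r)
  have hL : 0 < L := by positivity
  let toCube : (Option ι → ℝ) → ι → ℝ := fun p i => L * p (some i) - r
  let toSimplex : (ι → ℝ) → Option ι → ℝ := fun y o =>
    o.elim (1 - ∑ i, (y i + r) / L) fun i => (y i + r) / L
  have hcont : Continuous fun p => toSimplex (G (toCube p)) := by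
    have hc : Continuous toCube := by fun_prop
    have hGc := hG.comp hc
    refine continuous_pi fun o => ?_
    cases o with
    | none =>
      exact continuous_const.sub (continuous_finsetSum _ fun i _ =>
        (((continuous_apply i).comp hGc).add continuous_const).div_const L)
    | some i => exact (((continuous_apply i).comp hGc).add continuous_const).div_const L
  have hmaps : ∀ y : ι → ℝ, (∀ i, |y i| ≤ r) → toSimplex y ∈ stdSimplex ℝ (Option ι) := by
    intro y hy
    refine ⟨fun o => ?_, ?_⟩
    · cases o with
      | none =>
        have : ∑ i, (y i + r) / L ≤ 1 := by
          rw [← sum_div, div_le_one hL]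
          calc ∑ i, (y i + r) ≤ ∑ _i : ι, 2 * r :=
                sum_le_sum fun i _ => by linarith [(abs_le.1 (hy i)).2]
            _ = L := by simp [L]
        simpa [toSimplex] using this
      | some i => exact div_nonneg (by linarith [(abs_le.1 (hy i)).1]) hL.le
    · rw [Fintype.sum_option]
      simp [toSimplex]
  obtain ⟨p, -, hp⟩ := exists_fixedPoint_stdSimplex (f := fun p => toSimplex (G (toCube p)))
    hcont.continuousOn fun p _ => hmaps _ (hGr _)
  refine ⟨toCube p, funext fun i => ?_⟩
  have hi : (G (toCube p) i + r) / L = p (some i) := congrFun hp (some i)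
  rw [div_eq_iff hL.ne'] at hi
  simp only [toCube] at hi ⊢
  linarith

end Brouwer

/-- An assignment of `dw`-weighted orthogonal projections onto a subspace is continuous. -/
lemma continuous_weighted_projection {ι : Type*} [Fintype ι] {dw : ι → ℝ} (hdw : ∀ p, 0 < dw p)
    {W : Submodule ℝ (ι → ℝ)} {Proj : (ι → ℝ) → ι → ℝ} (hmem : ∀ Q, Proj Q ∈ W)
    (horth : ∀ Q, ∀ w ∈ W, ∑ p, dw p * (Q p - Proj Q p) * w p = 0) : Continuous Proj := by
  have huniq : ∀ Q, ∀ v ∈ W, (∀ w ∈ W, ∑ p, dw p * (Q p - v p) * w p = 0) → Proj Q = v := by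
    intro Q v hv hvorth
    have hd := W.sub_mem (hmem Q) hv
    have hsum : ∑ p, dw p * (Proj Q p - v p) ^ 2 = 0 := by
      have h := congrArg₂ (· - ·) (hvorth _ hd) (horth Q _ hd)
      simp only [← Finset.sum_sub_distrib, sub_zero, Pi.sub_apply] at h
      rw [← h]
      exact Finset.sum_congr rfl fun p _ => by ring
    funext p
    have hp := (Finset.sum_eq_zero_iff_of_nonneg fun p _ =>
      mul_nonneg (hdw p).le (sq_nonneg _)).1 hsum p (Finset.mem_univ p)
    exact sub_eq_zero.1 (pow_eq_zero_iff two_ne_zero |>.1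
      ((mul_eq_zero.1 hp).resolve_left (hdw p).ne'))
  let linProj : (ι → ℝ) →ₗ[ℝ] ι → ℝ :=
    { toFun := Proj
      map_add' := fun x y => huniq _ _ (W.add_mem (hmem x) (hmem y)) fun w hw => by
        have h := congrArg₂ (· + ·) (horth x w hw) (horth y w hw)
        simp only [← Finset.sum_add_distrib, add_zero] at h
        rw [← h]
        refine Finset.sum_congr rfl fun p _ => ?_
        simp only [Pi.add_apply]
        ring
      map_smul' := fun a x => huniq _ _ (W.smul_mem a (hmem x)) fun w hw => by
        rw [← mul_zero a, ← horth x w hw, Finset.mul_sum]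
        refine Finset.sum_congr rfl fun p _ => ?_
        simp only [Pi.smul_apply, smul_eq_mul, RingHom.id_apply]
        ring }
  exact linProj.continuous_of_finiteDimensional

lemma continuous_trunc {ι : Type*} (r : ℝ) : Continuous (trunc r : (ι → ℝ) → ι → ℝ) :=
  continuous_pi fun i => continuous_const.max (continuous_const.min (continuous_apply i))

lemma abs_trunc_le {ι : Type*} {r : ℝ} (hr : 0 ≤ r) (x : ι → ℝ) (i : ι) : |trunc r x i| ≤ r :=
  abs_le.2 ⟨le_max_left _ _, max_le (by linarith) (min_le_left _ _)⟩

theorem truncated_projected_bellman_equation_has_solution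
    {S A : Type*} [Fintype S] [Fintype A] [Nonempty S] [Nonempty A]
    (P : S → A → S → ℝ)
    (hP0 : ∀ s a s', 0 ≤ P s a s')
    (hP1 : ∀ s a, ∑ s', P s a s' = 1)
    (R : S → A → ℝ)
    (hR0 : ∀ s a, 0 ≤ R s a) (hR1 : ∀ s a, R s a ≤ 1)
    (γ : ℝ) (hγ0 : 0 < γ) (hγ1 : γ < 1)
    (r : ℝ) (hr : r = 1 / (1 - γ))
    (H : ((S × A) → ℝ) → ((S × A) → ℝ))
    (hH : ∀ (Q : (S × A) → ℝ) (p : S × A), H Q p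
      = R p.1 p.2 + γ * ∑ s', P p.1 p.2 s' *
          Finset.univ.sup' Finset.univ_nonempty (fun a' => Q (s', a')))
    (dw : (S × A) → ℝ) (hdw : ∀ p, 0 < dw p)
    (W : Submodule ℝ ((S × A) → ℝ))
    (Proj : ((S × A) → ℝ) → ((S × A) → ℝ))
    (hProjMem : ∀ Q, Proj Q ∈ W)
    (hProjOrth : ∀ Q, ∀ w ∈ W, ∑ p, dw p * (Q p - Proj Q p) * w p = 0) :
    Continuous (fun Q : (S × A) → ℝ => trunc r (Proj (H Q))) ∧
    (∀ Q : (S × A) → ℝ,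
      Finset.univ.sup' Finset.univ_nonempty (fun p => |Q p|) ≤ r →
      Finset.univ.sup' Finset.univ_nonempty (fun p => |trunc r (Proj (H Q)) p|) ≤ r) ∧
    ∃ Qbar : (S × A) → ℝ,
      Finset.univ.sup' Finset.univ_nonempty (fun p => |Qbar p|) ≤ r ∧
      Qbar = trunc r (Proj (H Qbar)) := by
  have hr0 : 0 < r := hr ▸ one_div_pos.2 (sub_pos.2 hγ1)
  have hHcont : Continuous H := by
    refine continuous_pi fun p => ?_
    simp only [hH]
    refine continuous_const.add (continuous_const.mul (continuous_finsetSum _ fun s' _ =>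
      continuous_const.mul ?_))
    exact Continuous.finset_sup'_apply _ fun a' _ => continuous_apply (s', a')
  have hT : Continuous fun Q : (S × A) → ℝ => trunc r (Proj (H Q)) :=
    (continuous_trunc r).comp ((continuous_weighted_projection hdw hProjMem hProjOrth).comp hHcont)
  have hball : ∀ Q : (S × A) → ℝ,
      Finset.univ.sup' Finset.univ_nonempty (fun p => |trunc r (Proj (H Q)) p|) ≤ r := fun Q =>
    Finset.sup'_le _ _ fun p _ => abs_trunc_le hr0.le _ p
  obtain ⟨Qbar, hQ⟩ := exists_fixedPoint_of_abs_le hr0 hT fun Q p => abs_trunc_le hr0.le _ p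
  refine ⟨hT, fun Q _ => hball Q, Qbar, ?_, hQ.symm⟩
  have h := hball Qbar
  rwa [hQ] at h
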